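/- Let σ : (0,∞) → ℝ be defined by σ(x) = cos x − sin²x. Then: (a) ∫_0^∞ σ(x) h(x)² dx ≤ ∫_0^∞ h'(x)² dx for every C^∞ function h : ℝ → ℝ with compact support contained in (0,∞); but (b) there do NOT exist a locally integrable function Γ : (0,∞) → ℝ and a nonnegative locally finite Borel measure μ on (0,∞) such that both ∫_0^∞ σ(x) h(x) dx = −∫_0^∞ Γ(x) h'(x) dx − ∫_{(0,∞)} h dμ for every C^∞ function h with compact support in (0,∞) (i.e. σ = Γ' − μ in the sense of distributions on (0,∞)), and ∫_a^{a+1} |Γ(x)| dx → 0 as a → +∞. -/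

import Mathlib

open MeasureTheory Metric Set Filter
open scoped RealInnerProductSpace

noncomputable section

abbrev Euc (n : ℕ) := EuclideanSpace ℝ (Fin n)

/-- A test function on an open set `Ω ⊆ ℝⁿ`: a `C^∞` function with compact
support contained in `Ω`. -/
def IsTestFun {n : ℕ} (Ω : Set (Euc n)) (h : Euc n → ℝ) : Prop :=
  ContDiff ℝ (⊤ : ℕ∞) h ∧ HasCompactSupport h ∧ tsupport h ⊆ Ω

/-- `(m,M)`-ellipticity of a matrix (operator-valued) function on `Ω`. -/
def IsElliptic {n : ℕ} (Ω : Set (Euc n)) (A : Euc n → Euc n →L[ℝ] Euc n) (m M : ℝ) : Prop :=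
  ∀ᵐ x ∂(volume.restrict Ω), ∀ ξ : Euc n,
    m * ‖ξ‖ ^ 2 ≤ ⟪A x ξ, ξ⟫ ∧ ‖A x ξ‖ ≤ M * ‖ξ‖

/-- `A(x)` is symmetric for a.e. `x ∈ Ω`. -/
def IsSymmetricOn {n : ℕ} (Ω : Set (Euc n)) (A : Euc n → Euc n →L[ℝ] Euc n) : Prop :=
  ∀ᵐ x ∂(volume.restrict Ω), ∀ ξ η : Euc n, ⟪A x ξ, η⟫ = ⟪ξ, A x η⟫

/-- A vector field belongs to `L²_loc(Ω; ℝⁿ)`. -/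
def L2loc {n : ℕ} (Ω : Set (Euc n)) (Γ : Euc n → Euc n) : Prop :=
  ∀ K : Set (Euc n), K ⊆ Ω → IsCompact K → IntegrableOn (fun x => ‖Γ x‖ ^ 2) K

/-- A function is locally integrable on `Ω`. -/
def L1loc {n : ℕ} (Ω : Set (Euc n)) (f : Euc n → ℝ) : Prop :=
  ∀ K : Set (Euc n), K ⊆ Ω → IsCompact K → IntegrableOn f K

/-- `u ∈ L^{1,2}_loc(Ω)` with weak gradient `du ∈ L²_loc(Ω;ℝⁿ)`:
`u` is locally integrable and `∫ u ∂ᵢh = -∫ h (du)ᵢ` for all test functions `h`. -/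
def HasWeakGradOn {n : ℕ} (Ω : Set (Euc n)) (u : Euc n → ℝ) (du : Euc n → Euc n) : Prop :=
  L1loc Ω u ∧ L2loc Ω du ∧
    ∀ h : Euc n → ℝ, IsTestFun Ω h →
      ∫ x in Ω, u x • gradient h x = -∫ x in Ω, h x • du x

/-- Local ellipticity and boundedness of `A` on `Ω`: on every compact subset of
`Ω` there are constants `0 < m_K, M_K` as in `(m,M)`-ellipticity. -/
def IsLocallyElliptic {n : ℕ} (Ω : Set (Euc n)) (A : Euc n → Euc n →L[ℝ] Euc n) : Prop :=
  ∀ K : Set (Euc n), K ⊆ Ω → IsCompact K →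
    ∃ mK MK : ℝ, 0 < mK ∧ 0 < MK ∧
      ∀ᵐ x ∂(volume.restrict K), ∀ ξ : Euc n,
        mK * ‖ξ‖ ^ 2 ≤ ⟪A x ξ, ξ⟫ ∧ ‖A x ξ‖ ≤ MK * ‖ξ‖

/-- one-dimensional example: `σ(x) = cos x - sin²x` on `(0,∞)`
is semi-bounded but admits no representation `σ = Γ' - μ` with `μ ≥ 0` and
`∫_a^{a+1} |Γ| → 0` as `a → ∞`. -/
theorem statement_19 :
    (∀ h : ℝ → ℝ, ContDiff ℝ (⊤ : ℕ∞) h → HasCompactSupport h → tsupport h ⊆ Ioi (0 : ℝ) →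
      ∫ x in Ioi (0 : ℝ), (Real.cos x - Real.sin x ^ 2) * (h x) ^ 2
        ≤ ∫ x in Ioi (0 : ℝ), (deriv h x) ^ 2) ∧
    ¬ ∃ (Γ : ℝ → ℝ) (μ : Measure ℝ),
        (∀ K : Set ℝ, K ⊆ Ioi (0 : ℝ) → IsCompact K → IntegrableOn Γ K) ∧
        (∀ K : Set ℝ, K ⊆ Ioi (0 : ℝ) → IsCompact K → μ K < ⊤) ∧
        (∀ h : ℝ → ℝ, ContDiff ℝ (⊤ : ℕ∞) h → HasCompactSupport h → tsupport h ⊆ Ioi (0 : ℝ) →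
          ∫ x in Ioi (0 : ℝ), (Real.cos x - Real.sin x ^ 2) * h x
            = -(∫ x in Ioi (0 : ℝ), Γ x * deriv h x) - ∫ x in Ioi (0 : ℝ), h x ∂μ) ∧
        Tendsto (fun a : ℝ => ∫ x in Ioc a (a + 1), |Γ x|) atTop (nhds 0) := by
  constructor
  · intro h hh hc hs
    have hd : ContDiff ℝ (⊤ : ℕ∞) (deriv h) := by
      have : ContDiff ℝ ((⊤ : ℕ∞) + 1) h := by simpa using hh
      exact ((contDiff_succ_iff_deriv (n := ((⊤ : ℕ∞) : WithTop ℕ∞))).1 this).2.2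
    have hdc : Continuous (deriv h) := hd.continuous
    have hhc : Continuous h := hh.continuous
    have z1 : ∀ x, x ∉ Ioi (0 : ℝ) → h x = 0 := fun x hx =>
      image_eq_zero_of_notMem_tsupport (fun hx' => hx (hs hx'))
    have z2 : ∀ x, x ∉ Ioi (0 : ℝ) → deriv h x = 0 := fun x hx => by
      by_contra hne
      exact hx (hs (support_deriv_subset (Function.mem_support.2 hne)))
    rw [setIntegral_eq_integral_of_forall_compl_eq_zero (fun x hx => by rw [z1 x hx]; simp),
      setIntegral_eq_integral_of_forall_compl_eq_zero (fun x hx => by rw [z2 x hx]; simp)]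
    have hdcs : HasCompactSupport (deriv h) := hc.deriv
    have cs2 : HasCompactSupport (fun x => h x ^ 2) :=
      hc.comp_left (g := fun y : ℝ => y ^ 2) (by simp)
    have ds2 : HasCompactSupport (fun x => deriv h x ^ 2) :=
      hdcs.comp_left (g := fun y : ℝ => y ^ 2) (by simp)
    have i1 : Integrable (fun x => (Real.cos x - Real.sin x ^ 2) * (h x) ^ 2) :=
      Continuous.integrable_of_hasCompactSupport (by fun_prop) cs2.mul_left
    have i2 : Integrable (fun x => (deriv h x) ^ 2) :=
      Continuous.integrable_of_hasCompactSupport (by fun_prop) ds2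
    have i3 : Integrable (fun x => Real.sin x * (h x) ^ 2) :=
      Continuous.integrable_of_hasCompactSupport (by fun_prop) cs2.mul_left
    have i4 : Integrable (fun x => Real.cos x * (h x) ^ 2 + Real.sin x * (2 * h x * deriv h x)) := by
      refine Integrable.add
        (Continuous.integrable_of_hasCompactSupport (by fun_prop) cs2.mul_left)
        (Continuous.integrable_of_hasCompactSupport (by fun_prop) ?_)
      exact HasCompactSupport.mul_left (HasCompactSupport.mul_left hdcs)
    have hder : ∀ x, HasDerivAt (fun x => Real.sin x * (h x) ^ 2)
        (Real.cos x * (h x) ^ 2 + Real.sin x * (2 * h x * deriv h x)) x := fun x => by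
      have h1 : HasDerivAt h (deriv h x) x := (hh.differentiable (by simp) x).hasDerivAt
      have h2 := (Real.hasDerivAt_sin x).mul (h1.pow 2)
      refine HasDerivAt.congr_deriv h2 ?_
      simp
    have key := integral_eq_zero_of_hasDerivAt_of_integrable hder i4 i3
    have : ∫ x, (deriv h x) ^ 2 = ∫ x, ((deriv h x) ^ 2 +
        (Real.cos x * (h x) ^ 2 + Real.sin x * (2 * h x * deriv h x))) := by
      rw [integral_add i2 i4, key, add_zero]
    rw [this]
    refine integral_mono i1 (i2.add i4) fun x => ?_
    show (Real.cos x - Real.sin x ^ 2) * (h x) ^ 2 ≤ (deriv h x) ^ 2 +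
        (Real.cos x * (h x) ^ 2 + Real.sin x * (2 * h x * deriv h x))
    nlinarith [sq_nonneg (deriv h x + Real.sin x * h x)]
  · rintro ⟨Γ, μ, hΓ, -, hrep, hlim⟩
    let f : ContDiffBump (0 : ℝ) := ⟨1/4, 1/2, by norm_num, by norm_num⟩
    have fsm : ContDiff ℝ (⊤ : ℕ∞) f := f.contDiff
    have fcs : HasCompactSupport f := f.hasCompactSupport
    have fts : tsupport f = closedBall 0 (1/2) := f.tsupport_eq
    have f0 : ∀ x : ℝ, 1/2 ≤ |x| → f x = 0 := fun x hx =>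
      f.zero_of_le_dist (by simpa [Real.dist_eq, f] using hx)
    have fnn : ∀ x, 0 ≤ f x := fun x => f.nonneg
    have fdc : Continuous (deriv f) := fsm.continuous_deriv (by simp)
    have fd0 : ∀ x : ℝ, 1/2 < |x| → deriv f x = 0 := fun x hx => by
      by_contra hne
      have := support_deriv_subset (Function.mem_support.2 hne)
      rw [fts] at this
      simp at this
      norm_num at hx
      linarith
    obtain ⟨C, hC⟩ := fcs.deriv.exists_bound_of_continuous fdc
    have spos : ∀ x : ℝ, |x| < 1/2 → 0 < Real.cos x - Real.sin x ^ 2 := fun x hx => by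
      have h1 := Real.one_sub_sq_div_two_le_cos (x := x)
      have h2 : Real.sin x ^ 2 ≤ x ^ 2 := sq_le_sq.2 (Real.abs_sin_le_abs)
      have h3 : x ^ 2 < (1/2) ^ 2 := by
        rw [← sq_abs]; gcongr
      nlinarith
    set I := ∫ x, (Real.cos x - Real.sin x ^ 2) * f x with hI
    have Icont : Continuous (fun x => (Real.cos x - Real.sin x ^ 2) * f x) := by
      have := fsm.continuous
      fun_prop
    have Ipos : 0 < I := by
      refine Icont.integral_pos_of_hasCompactSupport_nonneg_nonzero
        (fcs.mul_left) (fun x => ?_) (x := 0) ?_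
      · show 0 ≤ (Real.cos x - Real.sin x ^ 2) * f x
        rcases lt_or_ge |x| (1/2) with hx | hx
        · exact mul_nonneg (spos x hx).le (fnn x)
        · rw [f0 x hx]; simp
      · have : f 0 = 1 := f.one_of_mem_closedBall (by simp [f])
        simp [this]
    have bound : ∀ k : ℕ, I ≤ C * ∫ x in Ioc (((k + 1 : ℕ) : ℝ) * (2 * Real.pi) - 1/2)
        (((k + 1 : ℕ) : ℝ) * (2 * Real.pi) - 1/2 + 1), |Γ x| := by
      intro k
      set c : ℝ := ((k + 1 : ℕ) : ℝ) * (2 * Real.pi) with hcdef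
      have hc1 : 1 < c := by
        have := Real.pi_gt_three
        rw [hcdef]; push_cast
        have : (0:ℝ) ≤ k := k.cast_nonneg
        nlinarith
      have gts : tsupport (fun x => f (x - c)) ⊆ Icc (c - 1/2) (c + 1/2) := by
        refine closure_minimal (fun x hx => ?_) isClosed_Icc
        by_contra hne
        refine hx (f0 _ ?_)
        by_contra hlt
        have := abs_lt.1 (not_le.1 hlt)
        exact hne ⟨by linarith [this.1], by linarith [this.2]⟩
      have gts' : tsupport (fun x => f (x - c)) ⊆ Ioi 0 :=
        gts.trans fun x hx => by have := hx.1; simp only [mem_Ioi]; linarith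
      have H := hrep (fun x => f (x - c)) (fsm.comp (contDiff_id.sub contDiff_const))
        (isCompact_Icc.of_isClosed_subset (isClosed_tsupport _) gts) gts'
      have e1 : ∫ x in Ioi (0 : ℝ), (Real.cos x - Real.sin x ^ 2) * f (x - c) = I := by
        rw [setIntegral_eq_integral_of_forall_compl_eq_zero (fun x hx => by
          rw [image_eq_zero_of_notMem_tsupport (f := fun x => f (x - c))
            (fun hx' => hx (gts' hx'))]; simp)]
        rw [hI, ← integral_sub_right_eq_self
          (fun x => (Real.cos x - Real.sin x ^ 2) * f x) c]
        congr 1; ext x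
        rw [hcdef, Real.cos_sub_nat_mul_two_pi, Real.sin_sub_nat_mul_two_pi]
      have e2 : ∀ x, deriv (fun x => f (x - c)) x = deriv f (x - c) := fun x => by
        rw [deriv_comp_sub_const]
      have e3 : 0 ≤ ∫ x in Ioi (0 : ℝ), f (x - c) ∂μ := integral_nonneg fun x => fnn _
      simp only [e2] at H
      rw [e1] at H
      have hsub : Ioc (c - 1/2) (c - 1/2 + 1) ⊆ Icc (c - 1/2) (c + 1/2) := fun x hx =>
        ⟨hx.1.le, by linarith [hx.2]⟩
      have hΓi : IntegrableOn Γ (Ioc (c - 1/2) (c - 1/2 + 1)) :=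
        (hΓ _ (fun x hx => by have := hx.1; simp only [mem_Ioi]; linarith)
          isCompact_Icc).mono_set hsub
      have e4 : ∫ x in Ioi (0 : ℝ), Γ x * deriv f (x - c)
          = ∫ x in Ioc (c - 1/2) (c - 1/2 + 1), Γ x * deriv f (x - c) := by
        have hz : ∀ x, x ∉ Icc (c - 1/2) (c + 1/2) → Γ x * deriv f (x - c) = 0 := fun x hx => by
          rw [fd0 _, mul_zero]
          by_contra hlt
          have := abs_le.1 (not_lt.1 hlt)
          exact hx ⟨by linarith [this.1], by linarith [this.2]⟩
        rw [setIntegral_eq_integral_of_forall_compl_eq_zero (fun x hx => hz x fun hx' => hx (by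
          have := hx'.1; simp only [mem_Ioi]; linarith)),
          ← setIntegral_eq_integral_of_forall_compl_eq_zero hz, integral_Icc_eq_integral_Ioc]
        congr 3; ring
      have e5 : ‖∫ x in Ioc (c - 1/2) (c - 1/2 + 1), Γ x * deriv f (x - c)‖
          ≤ ∫ x in Ioc (c - 1/2) (c - 1/2 + 1), C * |Γ x| := by
        refine norm_integral_le_of_norm_le (hΓi.abs.const_mul C) (Eventually.of_forall fun x => ?_)
        rw [norm_mul, mul_comm, Real.norm_eq_abs (Γ x)]
        exact mul_le_mul_of_nonneg_right (hC _) (abs_nonneg _)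
      rw [integral_const_mul, ← e4, Real.norm_eq_abs] at e5
      linarith [neg_abs_le (∫ x in Ioi (0 : ℝ), Γ x * deriv f (x - c))]
    have t1 : Tendsto (fun k : ℕ => ((k + 1 : ℕ) : ℝ) * (2 * Real.pi) - 1/2) atTop atTop := by
      refine tendsto_atTop_add_const_right _ _ (Tendsto.atTop_mul_const (by positivity) ?_)
      exact tendsto_natCast_atTop_atTop.comp (tendsto_add_atTop_nat 1)
    have t2 := (hlim.comp t1).const_mul C
    have := ge_of_tendsto' t2 bound
    simp at this
    linarith
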